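/- For every T > 0, every real α > -1/2 that is not an integer, and all i, j ∈ ℕ with i ≥ j, the matrix element of the multiplication operator with multiplier t^α relative to the Legendre polynomials satisfies A_{ij}^α = ∫₀^T t^α P̂(i,t) P̂(j,t) dt = √((2j+1)/T) · F_i^α · Σ_{k=0}^j (-1)^{j-k} · ∏_{m=1}^k [ ((α+m)/m)² · (j-m+1)/(α-i+m) · (j+m)/(α+i+m+1) ]. -/

import Mathlib

open MeasureTheory Finset

/-- Coefficients of the shifted Legendre polynomials:
`l_{ik} = (-1)^(i-k) * C(i+k, i) * C(i, i-k)`. -/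
noncomputable def legCoef (i k : ℕ) : ℝ :=
  (-1 : ℝ) ^ (i - k) * (Nat.choose (i + k) i : ℝ) * (Nat.choose i (i - k) : ℝ)

/-- Shifted Legendre polynomials on `[0, T]`, orthonormal in `L²([0,T])`:
`P̂(i,t) = √((2i+1)/T) · Σ_{k=0}^i l_{ik} (t/T)^k`. -/
noncomputable def legP (T : ℝ) (i : ℕ) (t : ℝ) : ℝ :=
  Real.sqrt ((2 * i + 1) / T) * ∑ k ∈ Finset.range (i + 1), legCoef i k * (t / T) ^ k

/-- `F_i^α = ∫₀^T t^α P̂(i,t) dt`, the expansion coefficient of the power function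
`t ↦ t^α` relative to the `i`-th Legendre polynomial. -/
noncomputable def Fcoef (T α : ℝ) (i : ℕ) : ℝ :=
  ∫ t in (0:ℝ)..T, t ^ α * legP T i t

/-- Rising factorial `x^{\overline{k}} = x(x+1)⋯(x+k-1)`. -/
noncomputable def riseFac (x : ℝ) (k : ℕ) : ℝ :=
  ∏ m ∈ Finset.range k, (x + m)

theorem succ_sq_mul_choose_mul_choose (j k : ℕ) :
    ((k : ℝ) + 1) ^ 2 * ((j + (k + 1)).choose j * j.choose (k + 1)) =
      ((j : ℝ) - k) * (j + k + 1) * ((j + k).choose j * j.choose k) := by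
  have h1 : ((j.choose (k + 1) : ℕ) : ℝ) * (k + 1) = j.choose k * ((j : ℝ) - k) := by
    rcases le_or_gt k j with h | h
    · have := Nat.choose_succ_right_eq j k
      rw [← Nat.cast_sub h]
      exact_mod_cast this
    · simp [Nat.choose_eq_zero_of_lt h, Nat.choose_eq_zero_of_lt (h.trans (Nat.lt_succ_self k))]
  have h2 : (((j + (k + 1)).choose j : ℕ) : ℝ) * (k + 1) =
      (j + k).choose j * ((j : ℝ) + k + 1) := by
    have := Nat.choose_mul_succ_eq (j + k) j
    rw [show j + k + 1 - j = k + 1 by omega, add_assoc] at this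
    rw [add_assoc]
    exact_mod_cast this.symm
  linear_combination ((j + (k + 1)).choose j : ℝ) * (k + 1) * h1 +
    (j.choose k : ℝ) * ((j : ℝ) - k) * h2

theorem legCoef_eq {i k : ℕ} (h : k ≤ i) :
    legCoef i k = (-1 : ℝ) ^ (i + k) * ((i + k).choose i * i.choose k) := by
  obtain ⟨d, rfl⟩ := Nat.exists_eq_add_of_le h
  have h2 : (-1 : ℝ) ^ (k + d + k) = (-1) ^ d := by
    rw [show k + d + k = 2 * k + d by ring, pow_add, pow_mul]; simp
  rw [legCoef, Nat.choose_symm h, h2, Nat.add_sub_cancel_left, mul_assoc]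

theorem legCoef_eq_prod {j k : ℕ} (h : k ≤ j) :
    legCoef j k = (-1 : ℝ) ^ (j - k) *
      ∏ m ∈ Icc 1 k, ((j : ℝ) - m + 1) * (j + m) / (m : ℝ) ^ 2 := by
  rw [legCoef, Nat.choose_symm h, mul_assoc]
  congr 1
  clear h
  induction k with
  | zero => simp
  | succ k ih =>
    rw [prod_Icc_succ_top (by omega), ← ih]
    have h := succ_sq_mul_choose_mul_choose j k
    have hk : (k : ℝ) + 1 ≠ 0 := by positivity
    push_cast
    field_simp
    linear_combination h

theorem sum_legCoef_div_succ (i : ℕ) {x : ℝ} (hx : 0 < x) :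
    (x - i) * (x + i + 1) * ∑ k ∈ range (i + 1), legCoef i k / (x + 1 + k) =
      x ^ 2 * ∑ k ∈ range (i + 1), legCoef i k / (x + k) := by
  rw [← sub_eq_zero, mul_sum, mul_sum, ← sum_sub_distrib]
  let g : ℕ → ℝ := fun k =>
    (k : ℝ) ^ 2 * ((-1 : ℝ) ^ (i + k) * ((i + k).choose i * i.choose k)) / (x + k)
  trans ∑ k ∈ range (i + 1), (g (k + 1) - g k)
  · refine sum_congr rfl fun k hk => ?_
    rw [legCoef_eq (Nat.lt_succ_iff.1 (mem_range.1 hk))]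
    have h := succ_sq_mul_choose_mul_choose i k
    have h1 : x + k ≠ 0 := by positivity
    have h2 : x + 1 + k ≠ 0 := by positivity
    have h3 : x + (k + 1) ≠ 0 := by positivity
    have h4 : (-1 : ℝ) ^ (i + (k + 1)) = -(-1) ^ (i + k) := by
      rw [← add_assoc, pow_succ]; ring
    simp only [g]
    push_cast
    rw [h4, show ((k : ℝ) + 1) ^ 2 * (-(-1) ^ (i + k) *
      (((i + (k + 1)).choose i : ℝ) * i.choose (k + 1))) =
      -(-1) ^ (i + k) * (((i : ℝ) - k) * (i + k + 1) * ((i + k).choose i * i.choose k)) by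
        rw [← h]; ring]
    rw [show x + ((k : ℝ) + 1) = x + 1 + k by ring]
    field_simp
    ring
  · rw [sum_range_sub]
    simp [g]

theorem continuous_legP (T : ℝ) (i : ℕ) : Continuous (legP T i) := by
  unfold legP
  fun_prop

theorem intervalIntegrable_rpow_mul_legP (T : ℝ) {β : ℝ} (hβ : -1 < β) (i : ℕ) :
    IntervalIntegrable (fun t => t ^ β * legP T i t) volume 0 T :=
  (intervalIntegral.intervalIntegrable_rpow' hβ).mul_continuousOn
    (continuous_legP T i).continuousOn

theorem Fcoef_eq_sum {T : ℝ} (hT : 0 < T) {β : ℝ} (hβ : -1 < β) (i : ℕ) :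
    Fcoef T β i = Real.sqrt ((2 * i + 1) / T) * T ^ (β + 1) *
      ∑ k ∈ range (i + 1), legCoef i k / (β + 1 + k) := by
  have hk (k : ℕ) : -1 < β + k := by linarith [(Nat.cast_nonneg k : (0 : ℝ) ≤ k)]
  have h1 : Fcoef T β i = ∫ t in (0 : ℝ)..T, ∑ k ∈ range (i + 1),
      (Real.sqrt ((2 * i + 1) / T) * legCoef i k / T ^ k) * t ^ (β + k) := by
    refine intervalIntegral.integral_congr_Ioo_of_le hT.le fun t ht => ?_
    simp only [legP]
    rw [mul_sum, mul_sum]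
    refine sum_congr rfl fun k _ => ?_
    rw [Real.rpow_add ht.1, Real.rpow_natCast, div_pow]
    ring
  rw [h1, intervalIntegral.integral_finsetSum fun k _ =>
    (intervalIntegral.intervalIntegrable_rpow' (hk k)).const_mul _, mul_sum]
  refine sum_congr rfl fun k _ => ?_
  have hne : β + 1 + k ≠ 0 := by linarith [hk k]
  have hTk : T ^ (β + k + 1) = T ^ (β + 1) * T ^ k := by
    rw [add_right_comm, Real.rpow_add hT, Real.rpow_natCast]
  rw [intervalIntegral.integral_const_mul, integral_rpow (Or.inl (hk k)), hTk,
    Real.zero_rpow (by linarith [hk k]), add_right_comm β k 1]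
  field_simp
  ring

theorem Fcoef_add_one {T : ℝ} (hT : 0 < T) {β : ℝ} (hβ : -1 < β) (i : ℕ) :
    (β + 1 - i) * (β + i + 2) * Fcoef T (β + 1) i = T * (β + 1) ^ 2 * Fcoef T β i := by
  have h := sum_legCoef_div_succ i (x := β + 1) (by linarith)
  rw [Fcoef_eq_sum hT hβ, Fcoef_eq_sum hT (by linarith : -1 < β + 1),
    Real.rpow_add_one hT.ne' (β + 1)]
  linear_combination Real.sqrt ((2 * i + 1) / T) * T ^ (β + 1) * T * h

theorem Fcoef_add_natCast {T : ℝ} (hT : 0 < T) {α : ℝ} (hα : -1 < α)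
    (hαint : ∀ n : ℤ, α ≠ n) (i k : ℕ) :
    Fcoef T (α + k) i = Fcoef T α i * T ^ k *
      ∏ m ∈ Icc 1 k, (α + m) ^ 2 / ((α - i + m) * (α + i + m + 1)) := by
  induction k with
  | zero => simp
  | succ k ih =>
    have h := Fcoef_add_one hT (β := α + k)
      (by linarith [(Nat.cast_nonneg k : (0 : ℝ) ≤ k)]) i
    rw [prod_Icc_succ_top (by omega)]
    have h1 : α - i + (k + 1) ≠ 0 := fun h0 =>
      hαint (i - (k + 1)) (by push_cast; linarith)
    have h2 : α + i + (k + 1) + 1 ≠ 0 := fun h0 =>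
      hαint (-(i + (k + 1) + 1)) (by push_cast; linarith)
    rw [ih] at h
    push_cast
    rw [← add_assoc α (k : ℝ) 1]
    generalize ∏ m ∈ Icc 1 k, (α + m) ^ 2 / ((α - i + m) * (α + i + m + 1)) = P at h ⊢
    field_simp
    linear_combination h

/-- for non-integer `α > -1/2` and `i ≥ j`, the matrix element of the
multiplication operator with multiplier `t^α` relative to the Legendre polynomials is
`A_{ij}^α = √((2j+1)/T) F_i^α Σ_{k=0}^j (-1)^{j-k}
  ∏_{m=1}^k ((α+m)/m)² (j-m+1)/(α-i+m) (j+m)/(α+i+m+1)`. -/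
theorem legP_mult_matrix (T : ℝ) (hT : 0 < T) (α : ℝ) (hα : -1/2 < α)
    (hαnotint : ∀ n : ℤ, α ≠ n) (i j : ℕ) (hij : j ≤ i) :
    (∫ t in (0:ℝ)..T, t ^ α * legP T i t * legP T j t) =
      Real.sqrt ((2 * j + 1) / T) * Fcoef T α i *
        ∑ k ∈ Finset.range (j + 1),
          (-1 : ℝ) ^ (j - k) *
            ∏ m ∈ Finset.Icc 1 k,
              (((α + m) / (m : ℝ)) ^ 2 * (((j : ℝ) - m + 1) / (α - i + m)) *
                (((j : ℝ) + m) / (α + i + m + 1))) := by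
  have hα' : -1 < α := by linarith
  have hk (k : ℕ) : -1 < α + k := by linarith [(Nat.cast_nonneg k : (0 : ℝ) ≤ k)]
  have h1 : (∫ t in (0 : ℝ)..T, t ^ α * legP T i t * legP T j t) =
      ∫ t in (0 : ℝ)..T, ∑ k ∈ range (j + 1),
        (Real.sqrt ((2 * j + 1) / T) * legCoef j k / T ^ k) *
          (t ^ (α + k) * legP T i t) := by
    refine intervalIntegral.integral_congr_Ioo_of_le hT.le fun t ht => ?_
    simp only [legP.eq_1 T j]
    rw [mul_sum, mul_sum]
    refine sum_congr rfl fun k _ => ?_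
    rw [Real.rpow_add ht.1, Real.rpow_natCast, div_pow]
    ring
  rw [h1, intervalIntegral.integral_finsetSum fun k _ =>
    (intervalIntegrable_rpow_mul_legP T (hk k) i).const_mul _, mul_sum]
  refine sum_congr rfl fun k hkj => ?_
  have hF := Fcoef_add_natCast hT hα' hαnotint i k
  have hprod : ∏ m ∈ Icc 1 k, (((α + m) / (m : ℝ)) ^ 2 * (((j : ℝ) - m + 1) / (α - i + m)) *
      (((j : ℝ) + m) / (α + i + m + 1))) =
      (∏ m ∈ Icc 1 k, ((j : ℝ) - m + 1) * (j + m) / (m : ℝ) ^ 2) *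
        ∏ m ∈ Icc 1 k, (α + m) ^ 2 / ((α - i + m) * (α + i + m + 1)) := by
    rw [← prod_mul_distrib]
    refine prod_congr rfl fun m _ => ?_
    simp only [div_eq_mul_inv, mul_inv, mul_pow, inv_pow]
    ring
  rw [intervalIntegral.integral_const_mul, ← Fcoef, hF, hprod,
    legCoef_eq_prod (Nat.lt_succ_iff.1 (mem_range.1 hkj))]
  field_simp
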